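/- With $m(x,\nu,\rho)$ as in the localized minimum problem for a surface energy with density bounded between $|\nu|/C$ and $C|\nu|$, for all $0<\rho_1<\rho_2<\mathrm{dist}(x_1,\partial\Omega)$ and $x_1,x_2\in\Omega$ with $|x_1-x_2|<\min\{\rho_1,\rho_2-\rho_1\}$ one has $m(x_2,\nu,\rho_2)\le m(x_1,\nu,\rho_1)+C\rho_1^{d-2}|x_1-x_2|+C\big(\rho_2^{d-1}-(\sqrt{\rho_1^2-|x_1-x_2|^2})^{d-1}\big)$. -/

import Mathlib

open MeasureTheory Metric Filter
open scoped RealInnerProductSpace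

variable {d : ℕ}

/-- `(σ, f)` is the interface representation of a spin field `u ∈ BV(Ω; {±1})`:
`u = ±1` a.e. in `Ω`, `σ = H^{d-1} ⌞ ∂*{u=1}` is locally finite in `Ω` and carried
by `Ω`, `f = ν_u` is the (unit) inner normal `σ`-a.e., and `Du = 2 f σ` in the sense
of distributions on `Ω`. -/
def IsSpinRep (Ω : Set (EuclideanSpace ℝ (Fin d))) (u : EuclideanSpace ℝ (Fin d) → ℝ)
    (σ : Measure (EuclideanSpace ℝ (Fin d)))
    (f : EuclideanSpace ℝ (Fin d) → EuclideanSpace ℝ (Fin d)) : Prop :=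
  (∀ᵐ x ∂volume, x ∈ Ω → u x = 1 ∨ u x = -1) ∧
  (∀ x ∈ Ω, ∃ s ∈ nhds x, σ s < ⊤) ∧ σ Ωᶜ = 0 ∧
  (∀ᵐ x ∂σ, ‖f x‖ = 1) ∧
  (∀ ψ : EuclideanSpace ℝ (Fin d) → ℝ, ContDiff ℝ (⊤ : ℕ∞) ψ → HasCompactSupport ψ →
    tsupport ψ ⊆ Ω → ∀ v : EuclideanSpace ℝ (Fin d),
      ∫ x, u x * fderiv ℝ ψ x v = -2 * ∫ x, ψ x * ⟪f x, v⟫ ∂σ)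

/-- The localized surface energy `E(u,A) = ∫_{∂*{u=1}∩A} g(x,ν_u) dH^{d-1}`, computed
through the interface representation `(σ, f)`. -/
noncomputable def surfE (g : EuclideanSpace ℝ (Fin d) → EuclideanSpace ℝ (Fin d) → ℝ)
    (σ : Measure (EuclideanSpace ℝ (Fin d)))
    (f : EuclideanSpace ℝ (Fin d) → EuclideanSpace ℝ (Fin d))
    (A : Set (EuclideanSpace ℝ (Fin d))) : ℝ :=
  ∫ x in A, g x (f x) ∂σ

/-- The half-space spin configuration `u_{x,ν}`. -/
noncomputable def ujump (x ν : EuclideanSpace ℝ (Fin d)) (y : EuclideanSpace ℝ (Fin d)) : ℝ :=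
  if 0 < ⟪y - x, ν⟫ then 1 else -1

/-- The localized minimum problem `m(x,ν,ρ)`: the least surface energy in `B_ρ(x)` of a
spin field equal to `u_{x,ν}` in a neighborhood of `∂B_ρ(x)`. -/
noncomputable def mloc (Ω : Set (EuclideanSpace ℝ (Fin d)))
    (g : EuclideanSpace ℝ (Fin d) → EuclideanSpace ℝ (Fin d) → ℝ)
    (x ν : EuclideanSpace ℝ (Fin d)) (ρ : ℝ) : ℝ :=
  sInf {e : ℝ | ∃ (v : EuclideanSpace ℝ (Fin d) → ℝ)
      (σ : Measure (EuclideanSpace ℝ (Fin d)))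
      (f : EuclideanSpace ℝ (Fin d) → EuclideanSpace ℝ (Fin d)),
    IsSpinRep Ω v σ f ∧
    (∃ δ : ℝ, 0 < δ ∧ ∀ᵐ y ∂volume, y ∈ Ω → |dist y x - ρ| < δ → v y = ujump x ν y) ∧
    e = surfE g σ f (ball x ρ)}

/-- Orthonormal coordinates adapted to a unit vector `ν`: a measure preserving linear splitting of
space into a hyperplane factor and the `ν`-direction. -/
theorem exists_adapted_coordinates (hd : 0 < d) (ν : EuclideanSpace ℝ (Fin d)) (hν : ‖ν‖ = 1) :
    ∃ e : (EuclideanSpace ℝ (Fin (d - 1)) × ℝ) ≃L[ℝ] EuclideanSpace ℝ (Fin d),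
      MeasurePreserving e volume volume ∧
      (∀ p q, ⟪e p, e q⟫ = ⟪p.1, q.1⟫ + p.2 * q.2) ∧ e (0, 1) = ν := by
  let W := WithLp 2 (EuclideanSpace ℝ (Fin (d - 1)) × ℝ)
  have hW : Module.finrank ℝ W = Module.finrank ℝ (EuclideanSpace ℝ (Fin d)) := by
    rw [(WithLp.linearEquiv 2 ℝ (EuclideanSpace ℝ (Fin (d - 1)) × ℝ)).finrank_eq]
    simp
    omega
  let A : W ≃ₗᵢ[ℝ] EuclideanSpace ℝ (Fin d) := 
    (stdOrthonormalBasis ℝ W).equiv (stdOrthonormalBasis ℝ _) (finCongr hW)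
  let u : W := WithLp.toLp 2 (0, 1)
  have hu : ‖A u‖ = ‖ν‖ := by
    rw [A.norm_map, hν, WithLp.prod_norm_eq_of_L2 u]
    simp [u]
  let T : W ≃ₗᵢ[ℝ] EuclideanSpace ℝ (Fin d) :=
    A.trans (Submodule.reflection (ℝ ∙ (A u - ν))ᗮ)
  have hT : T u = ν := Submodule.reflection_sub hu
  refine ⟨(WithLp.prodContinuousLinearEquiv 2 ℝ _ _).symm.trans T.toContinuousLinearEquiv,
    ?_, ?_, ?_⟩
  · exact T.measurePreserving.comp (WithLp.volume_preserving_toLp _ _)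
  · intro p q
    have : ⟪T (WithLp.toLp 2 p), T (WithLp.toLp 2 q)⟫ = ⟪p.1, q.1⟫ + p.2 * q.2 := by
      rw [T.inner_map_map, WithLp.prod_inner_apply]
      simp [mul_comm]
    exact this
  · exact hT

/-- Integrating a directional derivative, with a direction depending on the first variable only,
against the sign of the second variable. -/
theorem integral_sign_mul_fderiv {F : Type*} [NormedAddCommGroup F] [InnerProductSpace ℝ F]
    [FiniteDimensional ℝ F] [MeasurableSpace F] [BorelSpace F]
    {φ : F × ℝ → ℝ} (hφ : ContDiff ℝ 1 φ) (hc : HasCompactSupport φ)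
    (a : F) {k : F → ℝ} (hk : Continuous k) :
    ∫ p : F × ℝ, (if 0 < p.2 then (1 : ℝ) else -1) * fderiv ℝ φ p (a, k p.1) =
      -2 * ∫ z, k z * φ (z, 0) := by
  have hmeas : Measurable fun p : F × ℝ => (if 0 < p.2 then (1 : ℝ) else -1) :=
    Measurable.ite (measurableSet_lt measurable_const measurable_snd) measurable_const
      measurable_const
  have hbd : ∀ p : F × ℝ, ‖(if 0 < p.2 then (1 : ℝ) else -1)‖ ≤ 1 := by
    intro p; split_ifs <;> simp
  have hD : Continuous (fderiv ℝ φ) := hφ.continuous_fderiv one_ne_zero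
  have hDc : HasCompactSupport (fderiv ℝ φ) := hc.fderiv ℝ
  have hi : ∀ w : F × ℝ → F × ℝ, Continuous w →
      Integrable (fun p => (if 0 < p.2 then (1 : ℝ) else -1) * fderiv ℝ φ p (w p)) := by
    intro w hw
    refine Integrable.bdd_mul (c := 1) ?_ hmeas.aestronglyMeasurable (ae_of_all _ hbd)
    refine Continuous.integrable_of_hasCompactSupport (hD.clm_apply hw) ?_
    refine hDc.mono fun p hp => ?_
    contrapose! hp
    simp only [Function.mem_support, not_not] at hp ⊢
    simp [hp]
  have hsplit : ∀ p : F × ℝ, (if 0 < p.2 then (1 : ℝ) else -1) * fderiv ℝ φ p (a, k p.1) =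
      (if 0 < p.2 then (1 : ℝ) else -1) * fderiv ℝ φ p (a, 0) +
        (if 0 < p.2 then (1 : ℝ) else -1) * fderiv ℝ φ p (0, k p.1) := by
    intro p
    rw [← mul_add, ← map_add]; simp
  simp_rw [hsplit]
  rw [integral_add (hi (fun _ => (a, 0)) continuous_const)
    (hi (fun p => (0, k p.1)) (by fun_prop))]
  have h1 : ∫ p : F × ℝ, (if 0 < p.2 then (1 : ℝ) else -1) * fderiv ℝ φ p (a, 0) = 0 := by
    rw [Measure.volume_eq_prod, integral_prod_symm _ (hi (fun _ => (a, 0)) continuous_const)]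
    have : ∀ s : ℝ, ∫ z : F, (if 0 < s then (1 : ℝ) else -1) * fderiv ℝ φ (z, s) (a, 0) = 0 := by
      intro s
      have hφs : ContDiff ℝ 1 fun z : F => φ (z, s) :=
        hφ.comp (contDiff_id.prodMk contDiff_const)
      have hcs : HasCompactSupport fun z : F => φ (z, s) := by
        refine hc.comp_isClosedEmbedding (g := fun z : F => (z, s)) (Isometry.isClosedEmbedding ?_)
        exact Isometry.of_dist_eq fun x y => by simp [Prod.dist_eq]
      have hder : ∀ z, fderiv ℝ (fun z : F => φ (z, s)) z a = fderiv ℝ φ (z, s) (a, 0) := by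
        intro z
        have h := HasFDerivAt.comp (f := fun z : F => (z, s)) z
          (hφ.differentiable one_ne_zero (z, s)).hasFDerivAt
          ((hasFDerivAt_id z).prodMk (hasFDerivAt_const s z))
        have h' := h.fderiv
        simp only [Function.comp_def] at h'
        rw [h']; simp
      rw [integral_const_mul]
      have := integral_mul_fderiv_eq_neg_fderiv_mul_of_integrable (μ := (volume : Measure F))
        (f := fun _ => (1 : ℝ)) (g := fun z : F => φ (z, s)) (v := a) (by simp)
        (by
          simp only [one_mul]
          refine Continuous.integrable_of_hasCompactSupport
            ((hφs.continuous_fderiv one_ne_zero).clm_apply continuous_const) ?_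
          refine (hcs.fderiv ℝ).mono fun p hp => ?_
          contrapose! hp
          simp only [Function.mem_support, not_not] at hp ⊢
          simp [hp])
        (by simpa using hφs.continuous.integrable_of_hasCompactSupport hcs)
        (by simp) (fun z _ => hφs.differentiable one_ne_zero z)
      simp only [one_mul, hder] at this
      rw [this]; simp
    simp_rw [this]; simp
  have h2 : ∫ p : F × ℝ, (if 0 < p.2 then (1 : ℝ) else -1) * fderiv ℝ φ p (0, k p.1) =
      -2 * ∫ z, k z * φ (z, 0) := by
    rw [Measure.volume_eq_prod, integral_prod _ (hi (fun p => (0, k p.1)) (by fun_prop)),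
      ← integral_const_mul]
    refine integral_congr_ae (ae_of_all _ fun z => ?_)
    have hφs : ContDiff ℝ 1 fun s : ℝ => φ (z, s) :=
      hφ.comp (contDiff_const.prodMk contDiff_id)
    have hcs : HasCompactSupport fun s : ℝ => φ (z, s) := by
      refine hc.comp_isClosedEmbedding (g := fun s : ℝ => (z, s)) (Isometry.isClosedEmbedding ?_)
      exact Isometry.of_dist_eq fun x y => by simp [Prod.dist_eq]
    have hder : ∀ s, fderiv ℝ φ (z, s) (0, k z) = k z * deriv (fun s : ℝ => φ (z, s)) s := by
      intro s
      have h := ((hφ.differentiable one_ne_zero (z, s)).hasFDerivAt).comp_hasDerivAt s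
        ((hasDerivAt_const s z).prodMk (hasDerivAt_id s))
      have h' := h.deriv
      simp only [Function.comp_def] at h'
      rw [h', ← smul_eq_mul, ← map_smul]; simp
    simp only [hder]
    have hInt : Integrable (fun s => deriv (fun s : ℝ => φ (z, s)) s) :=
      (hφs.continuous_deriv le_rfl).integrable_of_hasCompactSupport hcs.deriv
    have hInt' : Integrable (fun s : ℝ => (if 0 < s then (1 : ℝ) else -1) *
        (k z * deriv (fun s : ℝ => φ (z, s)) s)) := by
      refine Integrable.bdd_mul (c := 1) (hInt.const_mul _) ?_
        (ae_of_all _ fun s => hbd (z, s))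
      exact (Measurable.ite measurableSet_Ioi measurable_const
        measurable_const).aestronglyMeasurable
    rw [← intervalIntegral.integral_Iic_add_Ioi (b := 0) hInt'.integrableOn hInt'.integrableOn]
    rw [setIntegral_congr_fun (g := fun s => -k z * deriv (fun s : ℝ => φ (z, s)) s)
      measurableSet_Iic (fun s hs => by simp [not_lt.2 (Set.mem_Iic.1 hs)]),
      setIntegral_congr_fun (g := fun s => k z * deriv (fun s : ℝ => φ (z, s)) s)
      measurableSet_Ioi (fun s hs => by simp [Set.mem_Ioi.1 hs]),
      integral_const_mul, integral_const_mul, hcs.integral_Iic_deriv_eq hφs,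
      hcs.integral_Ioi_deriv_eq hφs]
    ring
  rw [h1, h2, zero_add]

section Graph

set_option linter.unusedSectionVars false

variable {F E : Type*} [NormedAddCommGroup F] [InnerProductSpace ℝ F] [NormedAddCommGroup E]
  [InnerProductSpace ℝ E]

theorem norm_coordinates_sq {e : (F × ℝ) ≃L[ℝ] E}
    (he : ∀ p q, ⟪e p, e q⟫ = ⟪p.1, q.1⟫ + p.2 * q.2) (p : F × ℝ) :
    ‖e p‖ ^ 2 = ‖p.1‖ ^ 2 + p.2 ^ 2 := by
  rw [← real_inner_self_eq_norm_sq, he, real_inner_self_eq_norm_sq]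
  ring

theorem norm_coordinates_symm_fst_le {e : (F × ℝ) ≃L[ℝ] E}
    (he : ∀ p q, ⟪e p, e q⟫ = ⟪p.1, q.1⟫ + p.2 * q.2) (w : E) : ‖(e.symm w).1‖ ≤ ‖w‖ := by
  have := norm_coordinates_sq he (e.symm w)
  rw [e.apply_symm_apply] at this
  exact abs_le_of_sq_le_sq' (by nlinarith [sq_nonneg (e.symm w).2]) (norm_nonneg _) |>.2

variable [FiniteDimensional ℝ F] [MeasurableSpace F] [BorelSpace F]

/-- The (non-normalized) upward normal `(-∇h, 1)` of the graph of `h` in the coordinates `e`. -/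
noncomputable def graphConormal (e : (F × ℝ) ≃L[ℝ] E) (h : F → ℝ) (z : F) : E :=
  e (-gradient h z, 1)

/-- The point over `z` of the graph of `h`, in the coordinates `e` centered at `x`. -/
noncomputable def graphPoint (e : (F × ℝ) ≃L[ℝ] E) (x : E) (h : F → ℝ) (z : F) : E :=
  x + e (z, h z)

/-- The spin field whose interface is the graph of `h`. -/
noncomputable def graphSpin (e : (F × ℝ) ≃L[ℝ] E) (x : E) (h : F → ℝ) (y : E) : ℝ :=
  if h (e.symm (y - x)).1 < (e.symm (y - x)).2 then 1 else -1

/-- The unit normal of the graph of `h`, extended constantly in the vertical direction. -/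
noncomputable def graphNormal (e : (F × ℝ) ≃L[ℝ] E) (x : E) (h : F → ℝ) (y : E) : E :=
  ‖graphConormal e h (e.symm (y - x)).1‖⁻¹ • graphConormal e h (e.symm (y - x)).1

/-- The surface measure of the graph of `h`. -/
noncomputable def graphMeasure [MeasurableSpace E] (e : (F × ℝ) ≃L[ℝ] E) (x : E) (h : F → ℝ) :
    Measure E :=
  (volume.withDensity fun z => ENNReal.ofReal ‖graphConormal e h z‖).map (graphPoint e x h)

/-- The homeomorphism straightening the graph of `h`. -/
noncomputable def graphShear (e : (F × ℝ) ≃L[ℝ] E) (x : E) {h : F → ℝ} (hh : Continuous h) :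
    (F × ℝ) ≃ₜ E :=
  ({ toFun := fun p => (p.1, p.2 + h p.1)
     invFun := fun p => (p.1, p.2 - h p.1)
     left_inv := fun p => by simp
     right_inv := fun p => by simp
     continuous_toFun := by fun_prop
     continuous_invFun := by fun_prop } : (F × ℝ) ≃ₜ (F × ℝ)).trans
    (e.toHomeomorph.trans (Homeomorph.addLeft x))

theorem graphShear_apply (e : (F × ℝ) ≃L[ℝ] E) (x : E) {h : F → ℝ} (hh : Continuous h)
    (p : F × ℝ) : graphShear e x hh p = x + e (p.1, p.2 + h p.1) := rfl

theorem graphSpin_graphShear (e : (F × ℝ) ≃L[ℝ] E) (x : E) {h : F → ℝ} (hh : Continuous h)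
    (p : F × ℝ) : graphSpin e x h (graphShear e x hh p) = if 0 < p.2 then 1 else -1 := by
  simp [graphSpin, graphShear_apply]

theorem measurePreserving_graphShear [MeasurableSpace E] [BorelSpace E] [FiniteDimensional ℝ E]
    {e : (F × ℝ) ≃L[ℝ] E}
    (he : MeasurePreserving e volume volume) (x : E) {h : F → ℝ} (hh : Continuous h) :
    MeasurePreserving (graphShear e x hh) volume volume := by
  have h1 : MeasurePreserving (fun p : F × ℝ => (id p.1, p.2 + h p.1))
      (volume.prod volume) (volume.prod volume) :=
    (MeasurePreserving.id volume).skew_product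
      (g := fun z s => s + h z)
      (by
        have := hh.measurable
        exact measurable_snd.add (this.comp measurable_fst))
      (ae_of_all _ fun z => (measurePreserving_add_right volume (h z)).map_eq)
  exact (measurePreserving_add_left volume x).comp (he.comp h1)

theorem continuous_graphConormal (e : (F × ℝ) ≃L[ℝ] E) {h : F → ℝ} (hh : ContDiff ℝ 1 h) :
    Continuous (graphConormal e h) := by
  have : Continuous (gradient h) :=
    (InnerProductSpace.toDual ℝ F).symm.continuous.comp (hh.continuous_fderiv one_ne_zero)
  unfold graphConormal
  fun_prop

theorem continuous_graphPoint (e : (F × ℝ) ≃L[ℝ] E) (x : E) {h : F → ℝ} (hh : Continuous h) :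
    Continuous (graphPoint e x h) := by
  unfold graphPoint
  fun_prop

theorem graphConormal_inner {e : (F × ℝ) ≃L[ℝ] E}
    (he : ∀ p q, ⟪e p, e q⟫ = ⟪p.1, q.1⟫ + p.2 * q.2) (h : F → ℝ) (z : F) (w : E) :
    ⟪graphConormal e h z, w⟫ = (e.symm w).2 - fderiv ℝ h z (e.symm w).1 := by
  conv_lhs => rw [← e.apply_symm_apply w]
  rw [graphConormal, he, inner_neg_left, gradient, InnerProductSpace.toDual_symm_apply]
  ring

theorem one_le_norm_graphConormal {e : (F × ℝ) ≃L[ℝ] E}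
    (he : ∀ p q, ⟪e p, e q⟫ = ⟪p.1, q.1⟫ + p.2 * q.2) (h : F → ℝ) (z : F) :
    1 ≤ ‖graphConormal e h z‖ := by
  have := norm_coordinates_sq he (-gradient h z, 1)
  rw [graphConormal]
  simp only at this
  nlinarith [norm_nonneg (e (-gradient h z, 1)), sq_nonneg ‖-gradient h z‖]

theorem norm_graphConormal_le {e : (F × ℝ) ≃L[ℝ] E}
    (he : ∀ p q, ⟪e p, e q⟫ = ⟪p.1, q.1⟫ + p.2 * q.2) (h : F → ℝ) (z : F) :
    ‖graphConormal e h z‖ ≤ 1 + ‖fderiv ℝ h z‖ := by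
  have := norm_coordinates_sq he (-gradient h z, 1)
  have hg : ‖-gradient h z‖ = ‖fderiv ℝ h z‖ := by
    rw [norm_neg, gradient, LinearIsometryEquiv.norm_map]
  rw [graphConormal]
  simp only [hg] at this
  refine abs_le_of_sq_le_sq' ?_ (by positivity) |>.2
  nlinarith [norm_nonneg (fderiv ℝ h z)]

theorem measurable_graphSpin [MeasurableSpace E] [BorelSpace E] (e : (F × ℝ) ≃L[ℝ] E) (x : E)
    {h : F → ℝ} (hh : Continuous h) : Measurable (graphSpin e x h) := by
  have hc : Continuous fun y => e.symm (y - x) := by fun_prop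
  exact Measurable.ite (measurableSet_lt (hh.comp hc.fst).measurable hc.snd.measurable)
    measurable_const measurable_const

/-- The distributional derivative of `graphSpin` is twice the graph conormal. -/
theorem integral_graphSpin_mul_fderiv [MeasurableSpace E] [BorelSpace E] [FiniteDimensional ℝ E]
    {e : (F × ℝ) ≃L[ℝ] E} (hmp : MeasurePreserving e volume volume)
    (he : ∀ p q, ⟪e p, e q⟫ = ⟪p.1, q.1⟫ + p.2 * q.2) (x : E) {h : F → ℝ} (hh : ContDiff ℝ 1 h)
    {ψ : E → ℝ} (hψ : ContDiff ℝ 1 ψ) (hc : HasCompactSupport ψ) (w : E) :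
    ∫ y, graphSpin e x h y * fderiv ℝ ψ y w =
      -2 * ∫ z, ψ (graphPoint e x h z) * ⟪graphConormal e h z, w⟫ := by
  have hγ := measurePreserving_graphShear hmp x hh.continuous
  rw [← hγ.integral_comp (graphShear e x hh.continuous).measurableEmbedding]
  have hγd : ContDiff ℝ 1 (graphShear e x hh.continuous) := by
    change ContDiff ℝ 1 fun p : F × ℝ => x + e (p.1, p.2 + h p.1)
    fun_prop
  have hφ : ContDiff ℝ 1 (ψ ∘ graphShear e x hh.continuous) := hψ.comp hγd
  have hder : ∀ p : F × ℝ, fderiv ℝ ψ (graphShear e x hh.continuous p) w =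
      fderiv ℝ (ψ ∘ graphShear e x hh.continuous) p
        ((e.symm w).1, (e.symm w).2 - fderiv ℝ h p.1 (e.symm w).1) := by
    intro p
    have h1 : HasFDerivAt (fun p : F × ℝ => h p.1)
        ((fderiv ℝ h p.1).comp (ContinuousLinearMap.fst ℝ F ℝ)) p :=
      (hh.differentiable one_ne_zero p.1).hasFDerivAt.comp p hasFDerivAt_fst
    have h2 := (e.toContinuousLinearMap.hasFDerivAt.comp p
      (hasFDerivAt_fst.prodMk (hasFDerivAt_snd.add h1))).const_add x
    have h3 : HasFDerivAt (graphShear e x hh.continuous) _ p := h2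
    have h4 := (HasFDerivAt.comp p (hψ.differentiable one_ne_zero _).hasFDerivAt h3).fderiv
    rw [h4]
    simp
  simp_rw [graphSpin_graphShear, hder]
  rw [integral_sign_mul_fderiv hφ (hc.comp_homeomorph _) (e.symm w).1
    (k := fun z => (e.symm w).2 - fderiv ℝ h z (e.symm w).1)
    (continuous_const.sub ((hh.continuous_fderiv one_ne_zero).clm_apply continuous_const))]
  congr 1
  refine integral_congr_ae (ae_of_all _ fun z => ?_)
  simp only [graphConormal_inner he, Function.comp_apply, graphShear_apply, graphPoint, zero_add]
  ring

theorem continuous_graphNormal {e : (F × ℝ) ≃L[ℝ] E}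
    (he : ∀ p q, ⟪e p, e q⟫ = ⟪p.1, q.1⟫ + p.2 * q.2) (x : E) {h : F → ℝ} (hh : ContDiff ℝ 1 h) :
    Continuous (graphNormal e x h) := by
  have h1 := continuous_graphConormal e hh
  have h2 : Continuous fun y => graphConormal e h (e.symm (y - x)).1 := h1.comp (by fun_prop)
  refine Continuous.smul (h2.norm.inv₀ fun y => ?_) h2
  have := one_le_norm_graphConormal he h (e.symm (y - x)).1
  positivity

theorem norm_graphNormal {e : (F × ℝ) ≃L[ℝ] E}
    (he : ∀ p q, ⟪e p, e q⟫ = ⟪p.1, q.1⟫ + p.2 * q.2) (x : E) (h : F → ℝ) (y : E) :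
    ‖graphNormal e x h y‖ = 1 := by
  have := one_le_norm_graphConormal he h (e.symm (y - x)).1
  rw [graphNormal, norm_smul, norm_inv, norm_norm, inv_mul_cancel₀ (by positivity)]

theorem integral_graphMeasure [MeasurableSpace E] [BorelSpace E]
    [SecondCountableTopology E] (e : (F × ℝ) ≃L[ℝ] E) (x : E)
    {h : F → ℝ} (hh : ContDiff ℝ 1 h) {φ : E → ℝ} (hφ : Continuous φ) :
    ∫ y, φ y ∂graphMeasure e x h = ∫ z, ‖graphConormal e h z‖ * φ (graphPoint e x h z) := by
  rw [graphMeasure, integral_map (continuous_graphPoint e x hh.continuous).measurable.aemeasurable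
    hφ.aestronglyMeasurable, integral_withDensity_eq_integral_toReal_smul
    (continuous_graphConormal e hh).norm.measurable.ennreal_ofReal
    (ae_of_all _ fun _ => ENNReal.ofReal_lt_top)]
  simp

theorem graphMeasure_apply [MeasurableSpace E] [BorelSpace E] (e : (F × ℝ) ≃L[ℝ] E) (x : E)
    {h : F → ℝ} (hh : Continuous h) {A : Set E} (hA : MeasurableSet A) :
    graphMeasure e x h A =
      ∫⁻ z in graphPoint e x h ⁻¹' A, ENNReal.ofReal ‖graphConormal e h z‖ := by
  have hm := (continuous_graphPoint e x hh).measurable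
  rw [graphMeasure, Measure.map_apply hm hA, withDensity_apply _ (hm hA)]

theorem isFiniteMeasureOnCompacts_graphMeasure [MeasurableSpace E] [BorelSpace E]
    (e : (F × ℝ) ≃L[ℝ] E) (x : E) {h : F → ℝ} (hh : ContDiff ℝ 1 h) :
    IsFiniteMeasureOnCompacts (graphMeasure e x h) := by
  refine ⟨fun K hK => ?_⟩
  have hm := (continuous_graphPoint e x hh.continuous).measurable
  have hloc : IsLocallyFiniteMeasure
      ((volume : Measure F).withDensity fun z => ENNReal.ofReal ‖graphConormal e h z‖) :=
    IsLocallyFiniteMeasure.withDensity_ofReal (continuous_graphConormal e hh).norm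
  have hK' : IsCompact ((fun y => (e.symm (y - x)).1) '' K) := hK.image (by fun_prop)
  rw [graphMeasure, Measure.map_apply hm hK.measurableSet]
  refine (measure_mono ?_).trans_lt hK'.measure_lt_top
  intro z hz
  exact ⟨graphPoint e x h z, hz, by simp [graphPoint]⟩

theorem integral_graphSpin_mul_fderiv_eq_graphMeasure [MeasurableSpace E] [BorelSpace E]
    [FiniteDimensional ℝ E]
    {e : (F × ℝ) ≃L[ℝ] E} (hmp : MeasurePreserving e volume volume)
    (he : ∀ p q, ⟪e p, e q⟫ = ⟪p.1, q.1⟫ + p.2 * q.2) (x : E) {h : F → ℝ} (hh : ContDiff ℝ 1 h)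
    {ψ : E → ℝ} (hψ : ContDiff ℝ 1 ψ) (hc : HasCompactSupport ψ) (w : E) :
    ∫ y, graphSpin e x h y * fderiv ℝ ψ y w =
      -2 * ∫ y, ψ y * ⟪graphNormal e x h y, w⟫ ∂graphMeasure e x h := by
  have := continuous_graphNormal he x hh
  have hcont : Continuous fun y => ψ y * ⟪graphNormal e x h y, w⟫ :=
    hψ.continuous.mul (this.inner continuous_const)
  rw [integral_graphSpin_mul_fderiv hmp he x hh hψ hc, integral_graphMeasure e x hh hcont]
  congr 1
  refine integral_congr_ae (ae_of_all _ fun z => ?_)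
  have h1 := one_le_norm_graphConormal he h z
  have h2 : graphNormal e x h (graphPoint e x h z) =
      ‖graphConormal e h z‖⁻¹ • graphConormal e h z := by
    simp [graphNormal, graphPoint]
  simp only [h2, real_inner_smul_left]
  field_simp

end Graph

/-- Graphs of `C¹` functions are interfaces of spin fields. -/
theorem isSpinRep_graphSpin {F : Type*} [NormedAddCommGroup F] [InnerProductSpace ℝ F]
    [FiniteDimensional ℝ F] [MeasurableSpace F] [BorelSpace F]
    {e : (F × ℝ) ≃L[ℝ] EuclideanSpace ℝ (Fin d)} (hmp : MeasurePreserving e volume volume)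
    (he : ∀ p q, ⟪e p, e q⟫ = ⟪p.1, q.1⟫ + p.2 * q.2) (x : EuclideanSpace ℝ (Fin d))
    {h : F → ℝ} (hh : ContDiff ℝ 1 h) {Ω : Set (EuclideanSpace ℝ (Fin d))} (hΩ : IsOpen Ω) :
    IsSpinRep Ω (graphSpin e x h) ((graphMeasure e x h).restrict Ω) (graphNormal e x h) := by
  have := isFiniteMeasureOnCompacts_graphMeasure e x hh
  refine ⟨ae_of_all _ fun y _ => ?_, fun y _ => ⟨closedBall y 1, closedBall_mem_nhds y one_pos,
    (Measure.restrict_apply_le _ _).trans_lt (isCompact_closedBall y 1).measure_lt_top⟩, ?_,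
    ae_of_all _ fun y => norm_graphNormal he x h y, fun ψ hψ hc hs w => ?_⟩
  · unfold graphSpin; split_ifs <;> simp
  · rw [Measure.restrict_apply hΩ.measurableSet.compl]; simp
  · rw [integral_graphSpin_mul_fderiv_eq_graphMeasure hmp he x hh (hψ.of_le (by norm_cast)) hc w,
      setIntegral_eq_integral_of_forall_compl_eq_zero]
    intro y hy
    rw [image_eq_zero_of_notMem_tsupport fun h => hy (hs h), zero_mul]

theorem coordinates_symm_snd {F : Type*} [NormedAddCommGroup F] [InnerProductSpace ℝ F]
    {e : (F × ℝ) ≃L[ℝ] EuclideanSpace ℝ (Fin d)} {ν : EuclideanSpace ℝ (Fin d)}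
    (he : ∀ p q, ⟪e p, e q⟫ = ⟪p.1, q.1⟫ + p.2 * q.2) (hν : e (0, 1) = ν)
    (w : EuclideanSpace ℝ (Fin d)) : (e.symm w).2 = ⟪w, ν⟫ := by
  conv_rhs => rw [← e.apply_symm_apply w, ← hν, he]
  simp

theorem ujump_eq_graphSpin {F : Type*} [NormedAddCommGroup F] [InnerProductSpace ℝ F]
    {e : (F × ℝ) ≃L[ℝ] EuclideanSpace ℝ (Fin d)} {ν : EuclideanSpace ℝ (Fin d)}
    (he : ∀ p q, ⟪e p, e q⟫ = ⟪p.1, q.1⟫ + p.2 * q.2) (hν : e (0, 1) = ν)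
    (x : EuclideanSpace ℝ (Fin d)) : ujump x ν = graphSpin e x (0 : F → ℝ) := by
  ext y
  simp only [ujump, graphSpin, coordinates_symm_snd he hν, Pi.zero_apply]

/-- A field that agrees with a half-space field near a sphere has a nonzero distributional
derivative, tested against a bump function of the ball, in every direction transversal to the
hyperplane. -/
theorem exists_bump_integral_mul_fderiv_ne_zero {Ω : Set (EuclideanSpace ℝ (Fin d))}
    {x ν : EuclideanSpace ℝ (Fin d)} (hν : ‖ν‖ = 1) {ρ R δ : ℝ} (hρ : 0 < ρ) (hR : ρ < R)
    (hΩ : closedBall x R ⊆ Ω) (hδ : 0 < δ) {v : EuclideanSpace ℝ (Fin d) → ℝ}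
    (hv : ∀ᵐ y ∂volume, y ∈ Ω → |dist y x - ρ| < δ → v y = ujump x ν y) :
    ∃ φ : EuclideanSpace ℝ (Fin d) → ℝ, ContDiff ℝ (⊤ : ℕ∞) φ ∧ HasCompactSupport φ ∧
      tsupport φ ⊆ Ω ∧ (∀ y ∈ ball x ρ, φ y = 1) ∧
      ∀ w, ⟪ν, w⟫ ≠ 0 → ∫ y, v y * fderiv ℝ φ y w ≠ 0 := by
  have hd : 0 < d := by
    rcases Nat.eq_zero_or_pos d with rfl | h
    · simp [Subsingleton.elim ν 0] at hν
    · exact h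
  obtain ⟨e, hmp, he, heν⟩ := exists_adapted_coordinates hd ν hν
  have hr : ρ < ρ + min (R - ρ) (δ / 2) := by
    have : 0 < min (R - ρ) (δ / 2) := lt_min (by linarith) (by linarith)
    linarith
  let φ : ContDiffBump x := ⟨ρ, ρ + min (R - ρ) (δ / 2), hρ, hr⟩
  have hone : ∀ y ∈ ball x ρ, φ y = 1 := fun y hy =>
    φ.one_of_mem_closedBall (ball_subset_closedBall hy)
  have hsupp : tsupport φ ⊆ closedBall x R := by
    rw [φ.tsupport_eq]
    exact closedBall_subset_closedBall (by
      change ρ + min (R - ρ) (δ / 2) ≤ R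
      linarith [min_le_left (R - ρ) (δ / 2)])
  refine ⟨φ, φ.contDiff, φ.hasCompactSupport, hsupp.trans hΩ, hone, fun w hw => ?_⟩
  have h1 : ∫ y, v y * fderiv ℝ φ y w = ∫ y, graphSpin e x 0 y * fderiv ℝ φ y w := by
    refine integral_congr_ae ?_
    filter_upwards [hv] with y hy
    by_cases hyt : y ∈ tsupport φ
    · by_cases hyb : y ∈ ball x ρ
      · have : φ =ᶠ[nhds y] fun _ => 1 := by
          filter_upwards [isOpen_ball.mem_nhds hyb] with z hz using hone z hz
        simp [this.fderiv_eq]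
      · rw [hy (hΩ (hsupp hyt)), ujump_eq_graphSpin he heν]
        rw [φ.tsupport_eq] at hyt
        have h1 : dist y x ≤ ρ + min (R - ρ) (δ / 2) := hyt
        have h2 : ρ ≤ dist y x := by simpa using hyb
        have h3 := min_le_right (R - ρ) (δ / 2)
        rw [abs_lt]; constructor <;> linarith
    · have : fderiv ℝ φ y = 0 := by
        by_contra h
        exact hyt (support_fderiv_subset ℝ h)
      simp [this]
  have h0 : ContDiff ℝ 1 (0 : EuclideanSpace ℝ (Fin (d - 1)) → ℝ) := contDiff_const
  rw [h1, integral_graphSpin_mul_fderiv hmp he x h0 φ.contDiff φ.hasCompactSupport]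
  have h2 : ∀ z, ⟪graphConormal e (0 : EuclideanSpace ℝ (Fin (d - 1)) → ℝ) z, w⟫ = ⟪ν, w⟫ := by
    intro z
    rw [graphConormal_inner he, coordinates_symm_snd he heν, real_inner_comm]
    simp [show (0 : EuclideanSpace ℝ (Fin (d - 1)) → ℝ) = fun _ => 0 from rfl]
  simp only [h2]
  rw [integral_mul_const]
  refine mul_ne_zero (by norm_num) (mul_ne_zero (ne_of_gt ?_) hw)
  have hcont : Continuous fun z => φ (graphPoint e x 0 z) :=
    φ.continuous.comp (continuous_graphPoint e x continuous_const)
  refine hcont.integral_pos_of_hasCompactSupport_nonneg_nonzero ?_ (fun z => φ.nonneg) (x := 0) ?_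
  · have := (φ.hasCompactSupport.comp_homeomorph
      (graphShear e x (h := (0 : EuclideanSpace ℝ (Fin (d - 1)) → ℝ)) continuous_const))
    have h3 := this.comp_isClosedEmbedding (g := fun z : EuclideanSpace ℝ (Fin (d - 1)) =>
      (z, (0 : ℝ))) (Isometry.isClosedEmbedding
        (Isometry.of_dist_eq fun a b => by simp [Prod.dist_eq]))
    convert h3 using 1
    ext z
    simp [graphShear_apply, graphPoint]
  · have : graphPoint e x 0 (0 : EuclideanSpace ℝ (Fin (d - 1))) = x := by
      have : ((0 : EuclideanSpace ℝ (Fin (d - 1))), (0 : ℝ)) = 0 := rfl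
      simp [graphPoint, this]
    rw [this, hone x (mem_ball_self hρ)]
    exact one_ne_zero

/-- Competitors of the localized minimum problem are measurable in the ball, together with their
normals. -/
theorem IsSpinRep.regular_on_ball {Ω : Set (EuclideanSpace ℝ (Fin d))}
    {x ν : EuclideanSpace ℝ (Fin d)} (hν : ‖ν‖ = 1) {ρ R δ : ℝ} (hρ : 0 < ρ) (hR : ρ < R)
    (hΩ : closedBall x R ⊆ Ω) (hδ : 0 < δ) {v : EuclideanSpace ℝ (Fin d) → ℝ}
    {σ : Measure (EuclideanSpace ℝ (Fin d))}
    {f : EuclideanSpace ℝ (Fin d) → EuclideanSpace ℝ (Fin d)} (hrep : IsSpinRep Ω v σ f)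
    (hv : ∀ᵐ y ∂volume, y ∈ Ω → |dist y x - ρ| < δ → v y = ujump x ν y) :
    AEStronglyMeasurable v (volume.restrict (ball x ρ)) ∧
      ∀ w, IntegrableOn (fun y => ⟪f y, w⟫) (ball x ρ) σ := by
  obtain ⟨φ, hφ, hφc, hφs, hφ1, hne⟩ :=
    exists_bump_integral_mul_fderiv_ne_zero hν hρ hR hΩ hδ hv
  have hid := hrep.2.2.2.2
  have hνν : ⟪ν, ν⟫ = 1 := by rw [real_inner_self_eq_norm_sq, hν]; norm_num
  have hInt0 : ∀ w, ⟪ν, w⟫ ≠ 0 →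
      (∫ y, φ y * ⟪f y, w⟫ ∂σ ≠ 0) ∧ Integrable (fun y => φ y * ⟪f y, w⟫) σ := by
    intro w hw
    have h1 := hne w hw
    rw [hid φ hφ hφc hφs w] at h1
    have h2 : ∫ y, φ y * ⟪f y, w⟫ ∂σ ≠ 0 := fun h => h1 (by rw [h, mul_zero])
    exact ⟨h2, by_contra fun h => h2 (integral_undef h)⟩
  have hInt : ∀ w, ⟪ν, w⟫ ≠ 0 → IntegrableOn (fun y => ⟪f y, w⟫) (ball x ρ) σ := by
    intro w hw
    refine (hInt0 w hw).2.integrableOn.congr_fun (fun y hy => ?_) measurableSet_ball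
    simp [hφ1 y hy]
  refine ⟨?_, fun w => ?_⟩
  · by_contra hmeas
    have hzero : ∀ ψ : EuclideanSpace ℝ (Fin d) → ℝ,
        (∀ y ∈ ball x ρ, fderiv ℝ ψ y ν = 1) → ∫ y, v y * fderiv ℝ ψ y ν = 0 := by
      intro ψ hψ
      refine integral_undef fun h => hmeas ?_
      refine (h.integrableOn (s := ball x ρ)).aestronglyMeasurable.congr ?_
      filter_upwards [ae_restrict_mem measurableSet_ball] with y hy
      simp [hψ y hy]
    let L : EuclideanSpace ℝ (Fin d) → ℝ := fun y => ⟪y - x, ν⟫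
    have hL : ContDiff ℝ (⊤ : ℕ∞) L := (contDiff_id.sub contDiff_const).inner ℝ contDiff_const
    have hder : ∀ c : ℝ, ∀ y ∈ ball x ρ, fderiv ℝ (fun y => φ y * (L y + c)) y ν = 1 := by
      intro c y hy
      have h1 : (fun y => φ y * (L y + c)) =ᶠ[nhds y] fun y => ⟪y - x, ν⟫ + c := by
        filter_upwards [isOpen_ball.mem_nhds hy] with z hz
        rw [hφ1 z hz, one_mul]
      have h2 : HasFDerivAt (fun y => ⟪y - x, ν⟫ + c)
          ((innerSL ℝ ν)) y := by
        have h3 : (fun y => ⟪y - x, ν⟫ + c) = fun y => innerSL ℝ ν y + (c - ⟪x, ν⟫) := by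
          ext y
          rw [inner_sub_left, innerSL_apply_apply, real_inner_comm ν y]
          ring
        rw [h3]
        exact (innerSL ℝ ν).hasFDerivAt.add_const _
      rw [h1.fderiv_eq, h2.fderiv, innerSL_apply_apply, hνν]
    have hvanish : ∀ c : ℝ, ∫ y, φ y * (L y + c) * ⟪f y, ν⟫ ∂σ = 0 := by
      intro c
      have h1 := hid (fun y => φ y * (L y + c)) (hφ.mul (hL.add contDiff_const))
        hφc.mul_right ((tsupport_mul_subset_left).trans hφs) ν
      rw [hzero _ (hder c)] at h1
      linarith
    obtain ⟨hI, hIi⟩ := hInt0 ν (by rw [hνν]; exact one_ne_zero)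
    have hLi : Integrable (fun y => φ y * L y * ⟪f y, ν⟫) σ := by
      obtain ⟨M, hM⟩ := hφc.isCompact.exists_bound_of_continuousOn hL.continuous.continuousOn
      refine (hIi.norm.const_mul M).mono' ?_ (ae_of_all _ fun y => ?_)
      · refine (hL.continuous.aestronglyMeasurable.mul hIi.aestronglyMeasurable).congr
          (ae_of_all _ fun y => ?_)
        simp only [Pi.mul_apply]
        ring
      · by_cases hy : y ∈ tsupport φ
        · rw [mul_comm (φ y), mul_assoc, norm_mul]
          exact mul_le_mul_of_nonneg_right (hM y hy) (norm_nonneg _)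
        · simp [image_eq_zero_of_notMem_tsupport hy]
    apply hI
    have h0 := hvanish 0
    have h1 := hvanish 1
    simp only [add_zero] at h0
    have h2 : ∀ y, φ y * (L y + 1) * ⟪f y, ν⟫ = φ y * L y * ⟪f y, ν⟫ + φ y * ⟪f y, ν⟫ :=
      fun y => by ring
    simp_rw [h2] at h1
    rwa [integral_add hLi hIi, h0, zero_add] at h1
  · by_cases hw : ⟪ν, w⟫ = 0
    · have h1 := (hInt (w + ν) (by rw [inner_add_right, hw, hνν]; norm_num)).sub
        (hInt ν (by rw [hνν]; norm_num))
      refine h1.congr_fun (fun y _ => ?_) measurableSet_ball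
      simp [inner_add_right]
    · exact hInt w hw

/-- Derivatives of test functions are integrable against spin fields. -/
theorem integrable_mul_fderiv_of_abs_le_one {Ω : Set (EuclideanSpace ℝ (Fin d))}
    {v : EuclideanSpace ℝ (Fin d) → ℝ} (hm : AEStronglyMeasurable v volume)
    (hv : ∀ᵐ y ∂volume, y ∈ Ω → v y = 1 ∨ v y = -1) {θ : EuclideanSpace ℝ (Fin d) → ℝ}
    (hθ : ContDiff ℝ (⊤ : ℕ∞) θ) (hc : HasCompactSupport θ) (hs : tsupport θ ⊆ Ω)
    (w : EuclideanSpace ℝ (Fin d)) : Integrable (fun y => v y * fderiv ℝ θ y w) := by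
  have hD : Continuous fun y => fderiv ℝ θ y w :=
    (hθ.continuous_fderiv (by simp)).clm_apply continuous_const
  have hDc : HasCompactSupport fun y => fderiv ℝ θ y w := by
    refine (hc.fderiv ℝ).mono fun p hp => ?_
    contrapose! hp
    simp only [Function.mem_support, not_not] at hp ⊢
    simp [hp]
  refine (hD.integrable_of_hasCompactSupport hDc).norm.mono'
    (hm.mul hD.aestronglyMeasurable) ?_
  filter_upwards [hv] with y hy
  by_cases hyt : y ∈ tsupport θ
  · rw [norm_mul]
    rcases hy (hs hyt) with h | h <;> simp [h]
  · have : fderiv ℝ θ y = 0 := by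
      by_contra h
      exact hyt (support_fderiv_subset ℝ h)
    simp [this]

open Classical in
/-- Two spin fields that agree in an inner annulus of a ball can be glued along the sphere without
creating interface on the sphere: the first one is kept inside the ball, the second outside. -/
theorem IsSpinRep.glue {Ω : Set (EuclideanSpace ℝ (Fin d))} {x : EuclideanSpace ℝ (Fin d)}
    {ρ δ : ℝ} (hρ : 0 < ρ) (hΩ : closedBall x ρ ⊆ Ω) (hδ : 0 < δ)
    {v u : EuclideanSpace ℝ (Fin d) → ℝ} {σ τ : Measure (EuclideanSpace ℝ (Fin d))}
    {f n : EuclideanSpace ℝ (Fin d) → EuclideanSpace ℝ (Fin d)}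
    (hv : IsSpinRep Ω v σ f) (hvm : AEStronglyMeasurable v (volume.restrict (ball x ρ)))
    (hf : ∀ w, IntegrableOn (fun y => ⟪f y, w⟫) (ball x ρ) σ)
    (hu : IsSpinRep Ω u τ n) (hum : Measurable u) (hn : Continuous n)
    [IsFiniteMeasureOnCompacts τ]
    (hvu : ∀ᵐ y ∂volume, y ∈ Ω → y ∈ ball x ρ → ρ - δ < dist y x → v y = u y) :
    IsSpinRep Ω ((ball x ρ).piecewise v u) (σ.restrict (ball x ρ) + τ.restrict (ball x ρ)ᶜ)
      ((ball x ρ).piecewise f n) := by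
  have hB : MeasurableSet (ball x ρ) := measurableSet_ball
  have hpm : ∀ᵐ y ∂volume, y ∈ Ω →
      (ball x ρ).piecewise v u y = 1 ∨ (ball x ρ).piecewise v u y = -1 := by
    filter_upwards [hv.1, hu.1] with y h1 h2 hy
    by_cases hyb : y ∈ ball x ρ
    · simpa [Set.piecewise_eq_of_mem _ _ _ hyb] using h1 hy
    · simpa [Set.piecewise_eq_of_notMem _ _ _ hyb] using h2 hy
  have hmeas : AEStronglyMeasurable ((ball x ρ).piecewise v u) volume :=
    AEStronglyMeasurable.piecewise hB hvm hum.aestronglyMeasurable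
  refine ⟨hpm, fun y hy => ?_, ?_, ?_, fun ψ hψ hc hs w => ?_⟩
  · obtain ⟨s, hs, hsσ⟩ := hv.2.1 y hy
    obtain ⟨t, ht, htτ⟩ := hu.2.1 y hy
    refine ⟨s ∩ t, inter_mem hs ht, ?_⟩
    rw [Measure.add_apply]
    exact ENNReal.add_lt_top.2
      ⟨(Measure.restrict_apply_le _ _).trans_lt ((measure_mono Set.inter_subset_left).trans_lt hsσ),
      (Measure.restrict_apply_le _ _).trans_lt
        ((measure_mono Set.inter_subset_right).trans_lt htτ)⟩
  · rw [Measure.add_apply, add_eq_zero]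
    exact ⟨le_antisymm ((Measure.restrict_apply_le _ _).trans hv.2.2.1.le) zero_le,
      le_antisymm ((Measure.restrict_apply_le _ _).trans hu.2.2.1.le) zero_le⟩
  · rw [ae_add_measure_iff, ae_restrict_iff' hB, ae_restrict_iff' hB.compl]
    constructor
    · filter_upwards [hv.2.2.2.1] with y h1 hy
      rwa [Set.piecewise_eq_of_mem _ _ _ hy]
    · filter_upwards [hu.2.2.2.1] with y h1 hy
      rwa [Set.piecewise_eq_of_notMem _ _ _ hy]
  · have hτint : Integrable (fun y => ψ y * ⟪n y, w⟫) τ :=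
      (hψ.continuous.mul (hn.inner continuous_const)).integrable_of_hasCompactSupport hc.mul_right
    have hσint : IntegrableOn (fun y => ψ y * ⟪f y, w⟫) (ball x ρ) σ := by
      obtain ⟨M, hM⟩ := hc.exists_bound_of_continuous hψ.continuous
      exact Integrable.bdd_mul (c := M) (hf w) hψ.continuous.aestronglyMeasurable
        (ae_of_all _ hM)
    have hRHS : ∫ y, ψ y * ⟪(ball x ρ).piecewise f n y, w⟫
          ∂(σ.restrict (ball x ρ) + τ.restrict (ball x ρ)ᶜ) =
        ∫ y in ball x ρ, ψ y * ⟪f y, w⟫ ∂σ + ∫ y in (ball x ρ)ᶜ, ψ y * ⟪n y, w⟫ ∂τ := by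
      have h1 : ∀ y ∈ ball x ρ, ψ y * ⟪f y, w⟫ = ψ y * ⟪(ball x ρ).piecewise f n y, w⟫ :=
        fun y hy => by rw [Set.piecewise_eq_of_mem _ _ _ hy]
      have h2 : ∀ y ∈ (ball x ρ)ᶜ, ψ y * ⟪n y, w⟫ = ψ y * ⟪(ball x ρ).piecewise f n y, w⟫ :=
        fun y hy => by rw [Set.piecewise_eq_of_notMem _ _ _ hy]
      rw [integral_add_measure (hσint.congr_fun h1 hB)
        (hτint.integrableOn.congr_fun h2 hB.compl), setIntegral_congr_fun hB h1,
        setIntegral_congr_fun hB.compl h2]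
    rw [hRHS]
    let r : ℕ → ℝ := fun k => ρ - ρ / (k + 2)
    have hrρ : Tendsto r atTop (nhds ρ) := by
      have h1 : Tendsto (fun k : ℕ => ρ / ((k : ℝ) + 2)) atTop (nhds 0) :=
        tendsto_const_nhds.div_atTop (tendsto_natCast_atTop_atTop.atTop_add tendsto_const_nhds)
      simpa [r] using tendsto_const_nhds.sub h1
    have hr0 : ∀ k, 0 < r k := by
      intro k
      have : ρ / ((k : ℝ) + 2) < ρ := div_lt_self hρ (by linarith [k.cast_nonneg (α := ℝ)])
      simp only [r]; linarith
    have hr1 : ∀ k, r k < ρ := by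
      intro k
      have : 0 < ρ / ((k : ℝ) + 2) := by positivity
      simp only [r]; linarith
    let χ : ∀ k : ℕ, ContDiffBump x := fun k =>
      ⟨r k, (r k + ρ) / 2, hr0 k, by linarith [hr1 k]⟩
    have hχle : ∀ k y, |χ k y| ≤ 1 := fun k y =>
      abs_le.2 ⟨by linarith [(χ k).nonneg (x := y)], (χ k).le_one⟩
    have hχ1 : ∀ k y, dist y x ≤ r k → χ k y = 1 := fun k y hy => (χ k).one_of_mem_closedBall hy
    have hχs : ∀ k, tsupport (χ k) ⊆ ball x ρ := by
      intro k
      rw [(χ k).tsupport_eq]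
      exact closedBall_subset_ball (by change (r k + ρ) / 2 < ρ; linarith [hr1 k])
    have hχ0 : ∀ k y, y ∉ ball x ρ → χ k y = 0 := fun k y hy =>
      image_eq_zero_of_notMem_tsupport fun h => hy (hχs k h)
    have hev : ∀ᶠ k in atTop, -2 * (∫ y in ball x ρ, χ k y * (ψ y * ⟪f y, w⟫) ∂σ +
        ∫ y, (1 - χ k y) * (ψ y * ⟪n y, w⟫) ∂τ) =
        ∫ y, (ball x ρ).piecewise v u y * fderiv ℝ ψ y w := by
      filter_upwards [hrρ.eventually (lt_mem_nhds (show ρ - δ < ρ by linarith))] with k hk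
      have hψ1 : ContDiff ℝ (⊤ : ℕ∞) fun y => χ k y * ψ y := (χ k).contDiff.mul hψ
      have hψ2 : ContDiff ℝ (⊤ : ℕ∞) fun y => (1 - χ k y) * ψ y :=
        (contDiff_const.sub (χ k).contDiff).mul hψ
      have hc1 : HasCompactSupport fun y => χ k y * ψ y := hc.mul_left
      have hc2 : HasCompactSupport fun y => (1 - χ k y) * ψ y := hc.mul_left
      have hs1 : tsupport (fun y => χ k y * ψ y) ⊆ Ω := tsupport_mul_subset_right.trans hs
      have hs2 : tsupport (fun y => (1 - χ k y) * ψ y) ⊆ Ω := tsupport_mul_subset_right.trans hs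
      have hsplit : ∀ y, (ball x ρ).piecewise v u y * fderiv ℝ ψ y w =
          (ball x ρ).piecewise v u y * fderiv ℝ (fun y => χ k y * ψ y) y w +
          (ball x ρ).piecewise v u y * fderiv ℝ (fun y => (1 - χ k y) * ψ y) y w := by
        intro y
        rw [← mul_add, ← add_apply, ← fderiv_fun_add (hψ1.differentiable (by simp) y)
          (hψ2.differentiable (by simp) y)]
        congr 4
        ext y
        ring
      simp_rw [hsplit]
      rw [integral_add (integrable_mul_fderiv_of_abs_le_one hmeas hpm hψ1 hc1 hs1 w)
        (integrable_mul_fderiv_of_abs_le_one hmeas hpm hψ2 hc2 hs2 w)]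
      have hI1 : ∫ y, (ball x ρ).piecewise v u y * fderiv ℝ (fun y => χ k y * ψ y) y w =
          ∫ y, v y * fderiv ℝ (fun y => χ k y * ψ y) y w := by
        refine integral_congr_ae (ae_of_all _ fun y => ?_)
        by_cases hy : y ∈ ball x ρ
        · simp only [Set.piecewise_eq_of_mem _ _ _ hy]
        · have : fderiv ℝ (fun y => χ k y * ψ y) y = 0 := by
            by_contra h
            exact hy (hχs k (tsupport_mul_subset_left (support_fderiv_subset ℝ h)))
          simp [this]
      have hI2 : ∫ y, (ball x ρ).piecewise v u y * fderiv ℝ (fun y => (1 - χ k y) * ψ y) y w =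
          ∫ y, u y * fderiv ℝ (fun y => (1 - χ k y) * ψ y) y w := by
        refine integral_congr_ae ?_
        filter_upwards [hvu] with y hy
        by_cases hyb : y ∈ ball x ρ
        · by_cases hyd : dist y x < r k
          · have h1 : (fun y => (1 - χ k y) * ψ y) =ᶠ[nhds y] fun _ => 0 := by
              filter_upwards [isOpen_ball.mem_nhds (mem_ball.2 hyd)] with z hz
              rw [hχ1 k z (mem_ball.1 hz).le, sub_self, zero_mul]
            simp [h1.fderiv_eq]
          · rw [Set.piecewise_eq_of_mem _ _ _ hyb,
              hy (hΩ (ball_subset_closedBall hyb)) hyb (by linarith)]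
        · rw [Set.piecewise_eq_of_notMem _ _ _ hyb]
      rw [hI1, hI2, hv.2.2.2.2 _ hψ1 hc1 hs1 w, hu.2.2.2.2 _ hψ2 hc2 hs2 w, ← mul_add]
      congr 2
      · rw [setIntegral_eq_integral_of_forall_compl_eq_zero]
        · simp_rw [mul_assoc]
        · intro y hy
          rw [hχ0 k y hy, zero_mul]
      · simp_rw [mul_assoc]
    refine tendsto_nhds_unique (tendsto_const_nhds.congr' (hev.mono fun k hk => hk.symm)) ?_
    refine Tendsto.const_mul _ (Tendsto.add ?_ ?_)
    · refine tendsto_integral_of_dominated_convergence (fun y => ‖ψ y * ⟪f y, w⟫‖)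
        (fun k => (χ k).continuous.aestronglyMeasurable.mul hσint.aestronglyMeasurable)
        hσint.norm (fun k => ae_of_all _ fun y => ?_) ?_
      · rw [norm_mul]
        exact mul_le_of_le_one_left (norm_nonneg _) (hχle k y)
      · filter_upwards [ae_restrict_mem hB] with y hy
        refine tendsto_const_nhds.congr' ?_
        filter_upwards [hrρ.eventually (lt_mem_nhds (mem_ball.1 hy))] with k hk
        rw [hχ1 k y hk.le, one_mul]
    · rw [← integral_indicator hB.compl]
      refine tendsto_integral_of_dominated_convergence (fun y => ‖ψ y * ⟪n y, w⟫‖)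
        (fun k => (continuous_const.sub (χ k).continuous).aestronglyMeasurable.mul
          hτint.aestronglyMeasurable)
        hτint.norm (fun k => ae_of_all _ fun y => ?_) (ae_of_all _ fun y => ?_)
      · rw [norm_mul]
        refine mul_le_of_le_one_left (norm_nonneg _) (abs_le.2 ⟨?_, ?_⟩)
        · linarith [(χ k).le_one (x := y)]
        · linarith [(χ k).nonneg (x := y)]
      · by_cases hy : y ∈ ball x ρ
        · rw [Set.indicator_of_notMem (by simpa using hy)]
          refine tendsto_const_nhds.congr' ?_
          filter_upwards [hrρ.eventually (lt_mem_nhds (mem_ball.1 hy))] with k hk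
          rw [hχ1 k y hk.le, sub_self, zero_mul]
        · rw [Set.indicator_of_mem hy]
          simp [hχ0 _ y hy]

theorem exists_bound_deriv_smoothTransition :
    ∃ K : ℝ, 0 < K ∧ ∀ x, |deriv Real.smoothTransition x| ≤ K := by
  have hc : Continuous (deriv Real.smoothTransition) :=
    (Real.smoothTransition.contDiff (n := 1)).continuous_deriv le_rfl
  obtain ⟨K, hK⟩ := (isCompact_Icc (a := (0 : ℝ)) (b := 1)).exists_bound_of_continuousOn
    hc.continuousOn
  refine ⟨max K 1, by positivity, fun x => ?_⟩
  by_cases hx : x ∈ Set.Icc (0 : ℝ) 1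
  · exact (hK x hx).trans (le_max_left _ _)
  · have h0 : deriv Real.smoothTransition x = 0 := by
      rw [Set.mem_Icc, not_and_or, not_le, not_le] at hx
      rcases hx with hx | hx
      · have : Real.smoothTransition =ᶠ[nhds x] fun _ => 0 := by
          filter_upwards [gt_mem_nhds hx] with y hy
          exact Real.smoothTransition.zero_of_nonpos hy.le
        rw [this.deriv_eq, deriv_const]
      · have : Real.smoothTransition =ᶠ[nhds x] fun _ => 1 := by
          filter_upwards [lt_mem_nhds hx] with y hy
          exact Real.smoothTransition.one_of_one_le hy.le
        rw [this.deriv_eq, deriv_const]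
    rw [h0, abs_zero]
    positivity

/-- Radial height profiles interpolating between the heights `0` and `t` in an annulus, with the
expected gradient bound. -/
theorem exists_height_profile (F : Type*) [NormedAddCommGroup F] [InnerProductSpace ℝ F] :
    ∃ M : ℝ, 0 < M ∧ ∀ a ε t : ℝ, 0 < a → 0 < ε → ∃ h : F → ℝ, ContDiff ℝ 1 h ∧
      (∀ z, ‖z‖ ≤ a → h z = 0) ∧ (∀ z, a + ε ≤ ‖z‖ → h z = t) ∧
      (∀ z, ∃ θ : ℝ, 0 ≤ θ ∧ θ ≤ 1 ∧ h z = t * θ) ∧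
      (∀ z, ‖fderiv ℝ h z‖ ≤ M * |t| / ε) ∧ (∀ z, a + ε < ‖z‖ → fderiv ℝ h z = 0) := by
  obtain ⟨K, hK0, hK⟩ := exists_bound_deriv_smoothTransition
  refine ⟨2 * K, by positivity, fun a ε t ha hε => ?_⟩
  have hD : 0 < (a + ε) ^ 2 - a ^ 2 := by nlinarith
  let q : F → ℝ := fun z => (‖z‖ ^ 2 - a ^ 2) / ((a + ε) ^ 2 - a ^ 2)
  have hq : ContDiff ℝ 1 q := ((contDiff_norm_sq ℝ).sub contDiff_const).div_const _
  have h1 : ∀ z, a + ε ≤ ‖z‖ → t * Real.smoothTransition (q z) = t := by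
    intro z hz
    rw [Real.smoothTransition.one_of_one_le, mul_one]
    rw [one_le_div hD]
    gcongr
  have h0 : ∀ z, a + ε < ‖z‖ →
      fderiv ℝ (fun z => t * Real.smoothTransition (q z)) z = 0 := by
    intro z hz
    have : (fun z => t * Real.smoothTransition (q z)) =ᶠ[nhds z] fun _ => t := by
      filter_upwards [continuous_norm.continuousAt.eventually (lt_mem_nhds hz)] with y hy
      exact h1 y hy.le
    simp [this.fderiv_eq]
  refine ⟨fun z => t * Real.smoothTransition (q z),
    contDiff_const.mul (Real.smoothTransition.contDiff.comp hq), fun z hz => ?_, h1, fun z =>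
    ⟨_, Real.smoothTransition.nonneg _, Real.smoothTransition.le_one _, rfl⟩, fun z => ?_, h0⟩
  · simp only
    rw [Real.smoothTransition.zero_of_nonpos, mul_zero]
    refine div_nonpos_of_nonpos_of_nonneg ?_ hD.le
    nlinarith [norm_nonneg z]
  · rcases lt_or_ge (a + ε) ‖z‖ with hz | hz
    · rw [h0 z hz, norm_zero]
      positivity
    · have e1 : HasFDerivAt q (((a + ε) ^ 2 - a ^ 2)⁻¹ • (2 • innerSL ℝ z)) z := by
        have := ((hasStrictFDerivAt_norm_sq z).hasFDerivAt.sub_const (a ^ 2)).mul_const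
          (((a + ε) ^ 2 - a ^ 2)⁻¹)
        exact this
      have e2 : HasDerivAt Real.smoothTransition (deriv Real.smoothTransition (q z)) (q z) :=
        ((Real.smoothTransition.contDiff (n := 1)).differentiable one_ne_zero _).hasDerivAt
      have e3 := ((e2.comp_hasFDerivAt z e1).const_mul t).fderiv
      simp only [Function.comp_apply] at e3
      rw [e3, norm_smul, norm_smul, norm_smul, ← Nat.cast_smul_eq_nsmul ℝ, norm_smul,
        innerSL_apply_norm, Real.norm_eq_abs, Real.norm_eq_abs, Real.norm_eq_abs, abs_inv,
        abs_of_pos hD]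
      have e4 : ((a + ε) ^ 2 - a ^ 2)⁻¹ * (‖((2 : ℕ) : ℝ)‖ * ‖z‖) ≤ 2 / ε := by
        rw [inv_mul_le_iff₀ hD]
        have : ((a + ε) ^ 2 - a ^ 2) * (2 / ε) = 2 * (2 * a + ε) := by field_simp; ring
        rw [this]
        simp
        linarith
      calc |t| * (|deriv Real.smoothTransition (q z)| *
            (((a + ε) ^ 2 - a ^ 2)⁻¹ * (‖((2 : ℕ) : ℝ)‖ * ‖z‖))) ≤ |t| * (K * (2 / ε)) := by
            gcongr
            exact hK _
        _ = 2 * K * |t| / ε := by ring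

section Annulus

variable {F : Type*} [NormedAddCommGroup F] [InnerProductSpace ℝ F] [FiniteDimensional ℝ F]
  [MeasurableSpace F] [BorelSpace F]

theorem volume_ball_eq_ofReal (p : F) {r : ℝ} (hr : 0 < r) :
    volume (ball p r) =
      ENNReal.ofReal (volume.real (ball (0 : F) 1) * r ^ Module.finrank ℝ F) := by
  rw [Measure.addHaar_ball_of_pos _ _ hr, mul_comm, ENNReal.ofReal_mul measureReal_nonneg,
    ofReal_measureReal measure_ball_lt_top.ne]

theorem volume_diff_ball_le (p : F) {a r : ℝ} (ha : 0 < a) (hr : 0 < r) {s : Set F}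
    (hs : s ⊆ closedBall p r) (hp : ball (0 : F) a ⊆ closedBall p r) :
    volume (s \ ball (0 : F) a) ≤ ENNReal.ofReal
      (volume.real (ball (0 : F) 1) * (r ^ Module.finrank ℝ F - a ^ Module.finrank ℝ F)) := by
  refine (measure_mono (Set.sdiff_subset_sdiff_left hs)).trans ?_
  rw [measure_sdiff hp measurableSet_ball.nullMeasurableSet measure_ball_lt_top.ne,
    Measure.addHaar_closedBall _ _ hr.le, ← Measure.addHaar_ball_of_pos _ p hr,
    volume_ball_eq_ofReal p hr, volume_ball_eq_ofReal 0 ha, mul_sub, ENNReal.ofReal_sub]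
  have : 0 ≤ volume.real (ball (0 : F) 1) := measureReal_nonneg
  positivity

/-- Area bound for the graph of a function that vanishes in `ball 0 a` and is locally constant away
from `closedBall 0 (a + ε)`. -/
theorem graphMeasure_ball_diff_ball_le {E : Type*} [NormedAddCommGroup E] [InnerProductSpace ℝ E]
    [MeasurableSpace E] [BorelSpace E] {e : (F × ℝ) ≃L[ℝ] E}
    (he : ∀ p q, ⟪e p, e q⟫ = ⟪p.1, q.1⟫ + p.2 * q.2) (x y : E) {h : F → ℝ}
    (hh : ContDiff ℝ 1 h) {a ε L r : ℝ} (ha : 0 < a) (hε : 0 < ε) (hL : 0 ≤ L)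
    (h0 : ∀ z, ‖z‖ ≤ a → h z = 0) (hD : ∀ z, ‖fderiv ℝ h z‖ ≤ L)
    (hD0 : ∀ z, a + ε < ‖z‖ → fderiv ℝ h z = 0) (hr : dist x y + a ≤ r) :
    graphMeasure e x h (ball y r \ ball x a) ≤ ENNReal.ofReal
      (volume.real (ball (0 : F) 1) * (r ^ Module.finrank ℝ F - a ^ Module.finrank ℝ F) +
      L * (volume.real (ball (0 : F) 1) *
        ((a + ε) ^ Module.finrank ℝ F - a ^ Module.finrank ℝ F))) := by
  have hr0 : 0 < r := by linarith [dist_nonneg (x := x) (y := y)]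
  set p : F := (e.symm (y - x)).1 with hp
  have hpn : ‖p‖ ≤ dist x y := by
    have := norm_coordinates_symm_fst_le he (y - x)
    rwa [← dist_eq_norm, dist_comm] at this
  have hsub : graphPoint e x h ⁻¹' (ball y r \ ball x a) ⊆ ball p r \ ball (0 : F) a := by
    rintro z ⟨hz1, hz2⟩
    rw [mem_ball, dist_eq_norm, graphPoint] at hz1 hz2
    refine ⟨?_, fun hz => hz2 ?_⟩
    · rw [mem_ball, dist_eq_norm]
      refine lt_of_le_of_lt ?_ hz1
      have := norm_coordinates_symm_fst_le he (e (z, h z) - (y - x))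
      rw [map_sub e.symm, e.symm_apply_apply] at this
      rwa [show x + e (z, h z) - y = e (z, h z) - (y - x) by abel]
    · rw [mem_ball_zero_iff] at hz
      rw [h0 z hz.le, add_sub_cancel_left]
      have := norm_coordinates_sq he (z, (0 : ℝ))
      simp only [ne_eq, OfNat.ofNat_ne_zero, not_false_eq_true, zero_pow, add_zero] at this
      rwa [(sq_eq_sq₀ (norm_nonneg _) (norm_nonneg _)).1 this]
  have hInt : ∀ z, ENNReal.ofReal ‖graphConormal e h z‖ ≤
      1 + (closedBall (0 : F) (a + ε)).indicator (fun _ => ENNReal.ofReal L) z := by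
    intro z
    by_cases hz : z ∈ closedBall (0 : F) (a + ε)
    · rw [Set.indicator_of_mem hz, ← ENNReal.ofReal_one, ← ENNReal.ofReal_add zero_le_one hL]
      exact ENNReal.ofReal_le_ofReal
        ((norm_graphConormal_le he h z).trans (by linarith [hD z]))
    · rw [Set.indicator_of_notMem hz, add_zero, ← ENNReal.ofReal_one]
      refine ENNReal.ofReal_le_ofReal ((norm_graphConormal_le he h z).trans ?_)
      rw [mem_closedBall_zero_iff, not_le] at hz
      simp [hD0 z hz]
  rw [graphMeasure_apply e x hh.continuous (measurableSet_ball.diff measurableSet_ball)]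
  have hω : 0 ≤ volume.real (ball (0 : F) 1) := measureReal_nonneg
  have har : a ≤ r := by linarith [dist_nonneg (x := x) (y := y)]
  have h1 : (0 : ℝ) ≤ r ^ Module.finrank ℝ F - a ^ Module.finrank ℝ F :=
    sub_nonneg.2 (pow_le_pow_left₀ ha.le har _)
  have h2 : (0 : ℝ) ≤ (a + ε) ^ Module.finrank ℝ F - a ^ Module.finrank ℝ F :=
    sub_nonneg.2 (pow_le_pow_left₀ ha.le (by linarith) _)
  calc ∫⁻ z in graphPoint e x h ⁻¹' (ball y r \ ball x a), ENNReal.ofReal ‖graphConormal e h z‖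
      ≤ ∫⁻ z in ball p r \ ball (0 : F) a, ENNReal.ofReal ‖graphConormal e h z‖ :=
        lintegral_mono_set hsub
    _ ≤ ∫⁻ z in ball p r \ ball (0 : F) a,
          (1 + (closedBall (0 : F) (a + ε)).indicator (fun _ => ENNReal.ofReal L) z) :=
        lintegral_mono hInt
    _ = volume (ball p r \ ball (0 : F) a) + ENNReal.ofReal L *
          volume (closedBall (0 : F) (a + ε) ∩ (ball p r \ ball (0 : F) a)) := by
        rw [lintegral_add_left measurable_const, setLIntegral_one,
          lintegral_indicator measurableSet_closedBall, setLIntegral_const,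
          Measure.restrict_apply measurableSet_closedBall]
    _ ≤ _ := by
        rw [ENNReal.ofReal_add (mul_nonneg hω h1) (mul_nonneg hL (mul_nonneg hω h2)),
          ENNReal.ofReal_mul hL]
        gcongr
        · refine volume_diff_ball_le p ha hr0 ball_subset_closedBall fun z hz => ?_
          rw [mem_ball_zero_iff] at hz
          rw [mem_closedBall, dist_eq_norm]
          linarith [norm_sub_le z p]
        · refine (measure_mono ?_).trans (volume_diff_ball_le 0 ha (by linarith)
            (subset_refl (closedBall (0 : F) (a + ε)))
            (ball_subset_closedBall.trans (closedBall_subset_closedBall (by linarith))))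
          exact fun z hz => ⟨hz.1, hz.2.2⟩

end Annulus

theorem add_pow_sub_pow_le {a ε : ℝ} (ha : 0 < a) (hε : 0 < ε) (hεa : ε ≤ a) (n : ℕ) :
    (a + ε) ^ n - a ^ n ≤ ε * (n * 2 ^ (n - 1) * a ^ (n - 1)) := by
  have h1 := Commute.mul_geom_sum₂ (Commute.all (a + ε) a) n
  rw [← h1, add_sub_cancel_left]
  gcongr
  have h2 : ∀ i ∈ Finset.range n, (a + ε) ^ i * a ^ (n - 1 - i) ≤ 2 ^ (n - 1) * a ^ (n - 1) := by
    intro i hi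
    have hi' : i + (n - 1 - i) = n - 1 := by
      have := Finset.mem_range.1 hi
      omega
    calc (a + ε) ^ i * a ^ (n - 1 - i) ≤ (2 * a) ^ i * (2 * a) ^ (n - 1 - i) := by
          gcongr <;> linarith
      _ = 2 ^ (n - 1) * a ^ (n - 1) := by rw [← pow_add, hi', mul_pow]
  calc _ ≤ ∑ i ∈ Finset.range n, (2 ^ (n - 1) * a ^ (n - 1) : ℝ) := Finset.sum_le_sum h2
    _ = _ := by rw [Finset.sum_const, Finset.card_range, nsmul_eq_mul]; ring

theorem graphSpin_eq_ujump_of_mem_ball {F : Type*} [NormedAddCommGroup F] [InnerProductSpace ℝ F]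
    {e : (F × ℝ) ≃L[ℝ] EuclideanSpace ℝ (Fin d)} {ν : EuclideanSpace ℝ (Fin d)}
    (he : ∀ p q, ⟪e p, e q⟫ = ⟪p.1, q.1⟫ + p.2 * q.2) (hν : e (0, 1) = ν)
    {x y : EuclideanSpace ℝ (Fin d)} {a : ℝ} {h : F → ℝ} (h0 : ∀ z, ‖z‖ ≤ a → h z = 0)
    (hy : y ∈ ball x a) : graphSpin e x h y = ujump x ν y := by
  have : ‖(e.symm (y - x)).1‖ ≤ a :=
    (norm_coordinates_symm_fst_le he _).trans (mem_ball_iff_norm.1 hy).le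
  rw [ujump, graphSpin, h0 _ this, coordinates_symm_snd he hν]

/-- Away from `closedBall x₂ (b + dist x₁ x₂)`, the graph of a height profile based at `x₁` and
reaching the height of `x₂` outside `ball 0 b` separates the space like the hyperplane through
`x₂`. -/
theorem graphSpin_eq_ujump_of_lt_dist {F : Type*} [NormedAddCommGroup F] [InnerProductSpace ℝ F]
    {e : (F × ℝ) ≃L[ℝ] EuclideanSpace ℝ (Fin d)} {ν : EuclideanSpace ℝ (Fin d)}
    (he : ∀ p q, ⟪e p, e q⟫ = ⟪p.1, q.1⟫ + p.2 * q.2) (hν : e (0, 1) = ν)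
    {x₁ x₂ y : EuclideanSpace ℝ (Fin d)} {b : ℝ} {h : F → ℝ}
    (h1 : ∀ z, b ≤ ‖z‖ → h z = ⟪x₂ - x₁, ν⟫)
    (hθ : ∀ z, ∃ θ : ℝ, 0 ≤ θ ∧ θ ≤ 1 ∧ h z = ⟪x₂ - x₁, ν⟫ * θ)
    (hy : b + dist x₁ x₂ < dist y x₂) : graphSpin e x₁ h y = ujump x₂ ν y := by
  set t := ⟪x₂ - x₁, ν⟫ with ht
  set q := e.symm (y - x₁) with hq
  have hyx : ⟪y - x₂, ν⟫ = q.2 - t := by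
    rw [hq, coordinates_symm_snd he hν, ht, ← inner_sub_left]
    congr 1
    abel
  suffices hiff : h q.1 < q.2 ↔ 0 < q.2 - t by
    rw [ujump, graphSpin, ← hq, hyx]
    simp only [hiff]
  rcases le_or_gt b ‖q.1‖ with hb | hb
  · rw [h1 _ hb, sub_pos]
  have hfar : |t| < |q.2 - t| := by
    by_contra! hle
    refine hy.not_ge ?_
    have e1 : y - x₂ = e (q.1, 0) + e ((0, q.2) - e.symm (x₂ - x₁)) := by
      rw [← map_add, ← add_sub_assoc, Prod.mk_add_mk, add_zero, zero_add, map_sub e, hq,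
        Prod.mk.eta, e.apply_symm_apply, e.apply_symm_apply]
      abel
    have e2 : ‖e (q.1, 0)‖ = ‖q.1‖ := by
      have := norm_coordinates_sq he (q.1, (0 : ℝ))
      simp only [ne_eq, OfNat.ofNat_ne_zero, not_false_eq_true, zero_pow, add_zero] at this
      exact (sq_eq_sq₀ (norm_nonneg _) (norm_nonneg _)).1 this
    have e3 : ‖e ((0, q.2) - e.symm (x₂ - x₁))‖ ≤ dist x₁ x₂ := by
      have a1 := norm_coordinates_sq he ((0, q.2) - e.symm (x₂ - x₁))
      have a2 := norm_coordinates_sq he (e.symm (x₂ - x₁))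
      rw [e.apply_symm_apply, ← dist_eq_norm, dist_comm, coordinates_symm_snd he hν] at a2
      simp only [Prod.fst_sub, Prod.snd_sub, zero_sub, norm_neg, coordinates_symm_snd he hν,
        ← ht] at a1 a2
      have a3 := sq_le_sq.2 hle
      exact abs_le_of_sq_le_sq' (by linarith) dist_nonneg |>.2
    rw [dist_eq_norm, e1]
    refine (norm_add_le _ _).trans ?_
    rw [e2]
    exact add_le_add hb.le e3
  obtain ⟨θ, hθ0, hθ1, hhθ⟩ := hθ q.1
  rw [hhθ, sub_pos]
  constructor <;> intro hlt
  · by_contra! hle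
    rw [abs_of_nonpos (by linarith : q.2 - t ≤ 0)] at hfar
    have : 0 ≤ |t| := abs_nonneg t
    have : t * θ ≥ -|t| := by nlinarith [neg_abs_le t]
    nlinarith [le_abs_self t, neg_abs_le t]
  · by_contra! hle
    rw [abs_of_pos (by linarith : 0 < q.2 - t)] at hfar
    nlinarith [le_abs_self t, neg_abs_le t]

theorem IsSpinRep.ae_mem {Ω : Set (EuclideanSpace ℝ (Fin d))} {u : EuclideanSpace ℝ (Fin d) → ℝ}
    {σ : Measure (EuclideanSpace ℝ (Fin d))}
    {f : EuclideanSpace ℝ (Fin d) → EuclideanSpace ℝ (Fin d)} (h : IsSpinRep Ω u σ f) :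
    ∀ᵐ y ∂σ, y ∈ Ω :=
  h.2.2.1

theorem IsSpinRep.ae_density_mem {Ω : Set (EuclideanSpace ℝ (Fin d))}
    {u : EuclideanSpace ℝ (Fin d) → ℝ} {σ : Measure (EuclideanSpace ℝ (Fin d))}
    {f : EuclideanSpace ℝ (Fin d) → EuclideanSpace ℝ (Fin d)} (h : IsSpinRep Ω u σ f) {C : ℝ}
    (hC : 0 < C) {g : EuclideanSpace ℝ (Fin d) → EuclideanSpace ℝ (Fin d) → ℝ}
    (hg : ∀ x ∈ Ω, ∀ ν, ‖ν‖ / C ≤ g x ν ∧ g x ν ≤ C * ‖ν‖) :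
    ∀ᵐ y ∂σ, 0 ≤ g y (f y) ∧ g y (f y) ≤ C := by
  filter_upwards [h.ae_mem, h.2.2.2.1] with y hy h1
  have := hg y hy (f y)
  rw [h1, mul_one] at this
  exact ⟨(by positivity : (0 : ℝ) ≤ 1 / C).trans this.1, this.2⟩

theorem IsSpinRep.surfE_nonneg {Ω : Set (EuclideanSpace ℝ (Fin d))}
    {u : EuclideanSpace ℝ (Fin d) → ℝ} {σ : Measure (EuclideanSpace ℝ (Fin d))}
    {f : EuclideanSpace ℝ (Fin d) → EuclideanSpace ℝ (Fin d)} (h : IsSpinRep Ω u σ f) {C : ℝ}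
    (hC : 0 < C) {g : EuclideanSpace ℝ (Fin d) → EuclideanSpace ℝ (Fin d) → ℝ}
    (hg : ∀ x ∈ Ω, ∀ ν, ‖ν‖ / C ≤ g x ν ∧ g x ν ≤ C * ‖ν‖)
    (A : Set (EuclideanSpace ℝ (Fin d))) : 0 ≤ surfE g σ f A :=
  integral_nonneg_of_ae (ae_restrict_of_ae ((h.ae_density_mem hC hg).mono fun _ hy => hy.1))

open Classical in
theorem IsSpinRep.surfE_piecewise_le {Ω : Set (EuclideanSpace ℝ (Fin d))}
    {v u : EuclideanSpace ℝ (Fin d) → ℝ} {σ τ : Measure (EuclideanSpace ℝ (Fin d))}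
    {f n : EuclideanSpace ℝ (Fin d) → EuclideanSpace ℝ (Fin d)}
    {B Q : Set (EuclideanSpace ℝ (Fin d))} (hv : IsSpinRep Ω v σ f)
    (hu : IsSpinRep Ω u (σ.restrict B + τ.restrict Bᶜ) (B.piecewise f n))
    {C : ℝ} (hC : 0 < C) {g : EuclideanSpace ℝ (Fin d) → EuclideanSpace ℝ (Fin d) → ℝ}
    (hg : ∀ x ∈ Ω, ∀ ν, ‖ν‖ / C ≤ g x ν ∧ g x ν ≤ C * ‖ν‖) (hB : MeasurableSet B)
    (hQ : MeasurableSet Q) (hBQ : B ⊆ Q) {A : ℝ} (hA0 : 0 ≤ A)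
    (hA : τ (Q \ B) ≤ ENNReal.ofReal A) :
    surfE g (σ.restrict B + τ.restrict Bᶜ) (B.piecewise f n) Q ≤ surfE g σ f B + C * A := by
  have hv0 := hv.surfE_nonneg hC hg B
  set σ' := σ.restrict B + τ.restrict Bᶜ with hσ'
  by_cases hi : IntegrableOn (fun y => g y (B.piecewise f n y)) Q σ'
  · have hin : ∫ y in B, g y (B.piecewise f n y) ∂σ' = surfE g σ f B := by
      have hr : σ'.restrict B = σ.restrict B := by
        rw [hσ', Measure.restrict_add, Measure.restrict_restrict hB, Set.inter_self,
          Measure.restrict_restrict hB, Set.inter_compl_self, Measure.restrict_empty, add_zero]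
      rw [hr, surfE]
      exact setIntegral_congr_fun hB fun y hy => by
        simp only [Set.piecewise_eq_of_mem _ _ _ hy]
    have hm : σ' (Q \ B) ≤ ENNReal.ofReal A := by
      rw [hσ', Measure.add_apply, Measure.restrict_apply (hQ.diff hB),
        Set.sdiff_inter_self, measure_empty, zero_add]
      exact (Measure.restrict_apply_le _ _).trans hA
    have hout : ∫ y in Q \ B, g y (B.piecewise f n y) ∂σ' ≤ C * A := by
      have hn : ∀ᵐ y ∂σ', y ∈ Q \ B → ‖g y (B.piecewise f n y)‖ ≤ C :=
        (hu.ae_density_mem hC hg).mono fun y hy _ => by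
          rw [Real.norm_eq_abs, abs_of_nonneg hy.1]
          exact hy.2
      refine (Real.le_norm_self _).trans ((norm_setIntegral_le_of_norm_le_const_ae'
        (hm.trans_lt ENNReal.ofReal_lt_top) hn).trans ?_)
      · gcongr
        exact ENNReal.toReal_le_of_le_ofReal hA0 hm
    rw [surfE, ← integral_inter_add_sdiff hB hi, Set.inter_eq_self_of_subset_right hBQ, hin]
    exact add_le_add_right hout _
  · rw [surfE, integral_undef hi]
    positivity

/-- Competitors of the localized problem at `x₁` extend to competitors at `x₂`, at the cost of the
area of a graph over an annulus. -/
theorem exists_mloc_competitor_le (hd : 0 < d) : ∃ K : ℝ, 0 ≤ K ∧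
    ∀ {C : ℝ}, 0 < C → ∀ {Ω : Set (EuclideanSpace ℝ (Fin d))}, IsOpen Ω →
    ∀ {g : EuclideanSpace ℝ (Fin d) → EuclideanSpace ℝ (Fin d) → ℝ},
      (∀ x ∈ Ω, ∀ ν, ‖ν‖ / C ≤ g x ν ∧ g x ν ≤ C * ‖ν‖) →
    ∀ {x₁ x₂ ν : EuclideanSpace ℝ (Fin d)}, ‖ν‖ = 1 →
    ∀ {ρ₁ ρ₂ δ : ℝ}, 0 < ρ₁ → dist x₁ x₂ + ρ₁ < ρ₂ → closedBall x₁ ρ₂ ⊆ Ω → 0 < δ →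
    ∀ {v : EuclideanSpace ℝ (Fin d) → ℝ} {σ : Measure (EuclideanSpace ℝ (Fin d))}
      {f : EuclideanSpace ℝ (Fin d) → EuclideanSpace ℝ (Fin d)}, IsSpinRep Ω v σ f →
      (∀ᵐ y ∂volume, y ∈ Ω → |dist y x₁ - ρ₁| < δ → v y = ujump x₁ ν y) →
    ∃ (v' : EuclideanSpace ℝ (Fin d) → ℝ) (σ' : Measure (EuclideanSpace ℝ (Fin d)))
      (f' : EuclideanSpace ℝ (Fin d) → EuclideanSpace ℝ (Fin d)), IsSpinRep Ω v' σ' f' ∧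
      (∃ δ' : ℝ, 0 < δ' ∧ ∀ᵐ y ∂volume, y ∈ Ω → |dist y x₂ - ρ₂| < δ' → v' y = ujump x₂ ν y) ∧
      surfE g σ' f' (ball x₂ ρ₂) ≤ surfE g σ f (ball x₁ ρ₁) +
        C * (K * (ρ₂ ^ (d - 1) - ρ₁ ^ (d - 1)) + K * (ρ₁ ^ (d - 2) * dist x₁ x₂)) := by
  classical
  obtain ⟨M, hM, hprofile⟩ := exists_height_profile (EuclideanSpace ℝ (Fin (d - 1)))
  set ω : ℝ := volume.real (ball (0 : EuclideanSpace ℝ (Fin (d - 1))) 1) with hω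
  have hω0 : 0 ≤ ω := measureReal_nonneg
  refine ⟨ω + M * ω * ((d - 1 : ℕ) * 2 ^ (d - 1 - 1)), by positivity, ?_⟩
  intro C hC Ω hΩ g hg x₁ x₂ ν hν ρ₁ ρ₂ δ hρ₁ hρ hball hδ v σ f hrep hv
  obtain ⟨e, hmp, he, heν⟩ := exists_adapted_coordinates hd ν hν
  set s := dist x₁ x₂ with hs
  have hs0 : 0 ≤ s := dist_nonneg
  set t := ⟪x₂ - x₁, ν⟫ with ht
  have hts : |t| ≤ s := by
    have := abs_real_inner_le_norm (x₂ - x₁) ν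
    rwa [hν, mul_one, ← dist_eq_norm, dist_comm] at this
  set ε := min ((ρ₂ - ρ₁ - s) / 3) ρ₁ with hε
  have hε0 : 0 < ε := lt_min (by linarith) hρ₁
  have hε1 : ε ≤ (ρ₂ - ρ₁ - s) / 3 := min_le_left _ _
  have hε2 : ε ≤ ρ₁ := min_le_right _ _
  obtain ⟨h, hh, h0, h1, hθ, hD, hD0⟩ := hprofile ρ₁ ε t hρ₁ hε0
  obtain ⟨hvm, hf⟩ := hrep.regular_on_ball hν hρ₁ (by linarith) hball hδ hv
  have hmem : ∀ y ∈ ball x₁ ρ₁, graphSpin e x₁ h y = ujump x₁ ν y := fun y hy =>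
    graphSpin_eq_ujump_of_mem_ball he heν h0 hy
  have := isFiniteMeasureOnCompacts_graphMeasure e x₁ hh
  have hglue := IsSpinRep.glue (u := graphSpin e x₁ h)
    (τ := (graphMeasure e x₁ h).restrict Ω) (n := graphNormal e x₁ h) hρ₁
    ((closedBall_subset_closedBall (by linarith)).trans hball) hδ hrep hvm hf
    (isSpinRep_graphSpin hmp he x₁ hh hΩ) (measurable_graphSpin e x₁ hh.continuous)
    (continuous_graphNormal he x₁ hh)
    (by
      filter_upwards [hv] with y hy hyΩ hyb hyd
      rw [hmem y hyb]
      refine hy hyΩ (abs_lt.2 ⟨by linarith, ?_⟩)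
      linarith [mem_ball.1 hyb])
  refine ⟨_, _, _, hglue, ⟨(ρ₂ - ρ₁ - s) / 3, by linarith, ae_of_all _ fun y _ hy => ?_⟩, ?_⟩
  · have hy' := (abs_lt.1 hy).1
    rw [Set.piecewise_eq_of_notMem]
    · exact graphSpin_eq_ujump_of_lt_dist he heν h1 hθ (by linarith)
    · rw [mem_ball, not_lt]
      linarith [dist_triangle y x₁ x₂]
  · have hA := graphMeasure_ball_diff_ball_le he x₁ x₂ hh (L := M * |t| / ε) hρ₁ hε0
      (by positivity) h0 hD hD0 hρ.le
    rw [finrank_euclideanSpace_fin, ← hω] at hA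
    have hpow : ρ₁ ^ (d - 1) ≤ ρ₂ ^ (d - 1) := pow_le_pow_left₀ hρ₁.le (by linarith) _
    have hA0 : ω * (ρ₂ ^ (d - 1) - ρ₁ ^ (d - 1)) +
        M * |t| / ε * (ω * ((ρ₁ + ε) ^ (d - 1) - ρ₁ ^ (d - 1))) ≤
        (ω + M * ω * ((d - 1 : ℕ) * 2 ^ (d - 1 - 1))) * (ρ₂ ^ (d - 1) - ρ₁ ^ (d - 1)) +
        (ω + M * ω * ((d - 1 : ℕ) * 2 ^ (d - 1 - 1))) * (ρ₁ ^ (d - 2) * s) := by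
      have a1 : M * |t| / ε * (ω * ((ρ₁ + ε) ^ (d - 1) - ρ₁ ^ (d - 1))) ≤
          M * s / ε * (ω * (ε * ((d - 1 : ℕ) * 2 ^ (d - 1 - 1) * ρ₁ ^ (d - 1 - 1)))) := by
        gcongr
        · exact mul_nonneg hω0 (sub_nonneg.2 (pow_le_pow_left₀ hρ₁.le (by linarith) _))
        · exact add_pow_sub_pow_le hρ₁ hε0 hε2 (d - 1)
      have a2 : M * s / ε * (ω * (ε * ((d - 1 : ℕ) * 2 ^ (d - 1 - 1) * ρ₁ ^ (d - 1 - 1)))) =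
          M * ω * ((d - 1 : ℕ) * 2 ^ (d - 1 - 1)) * (ρ₁ ^ (d - 2) * s) := by
        rw [show d - 1 - 1 = d - 2 by omega]
        field_simp
      rw [a2] at a1
      have a3 : 0 ≤ M * ω * ((d - 1 : ℕ) * 2 ^ (d - 1 - 1)) * (ρ₂ ^ (d - 1) - ρ₁ ^ (d - 1)) :=
        mul_nonneg (by positivity) (sub_nonneg.2 hpow)
      have a4 : 0 ≤ ω * (ρ₁ ^ (d - 2) * s) := by positivity
      linarith
    refine hrep.surfE_piecewise_le hglue hC hg measurableSet_ball measurableSet_ball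
      (ball_subset_ball' (by linarith)) ?_
      ((Measure.restrict_apply_le _ _).trans (hA.trans (ENNReal.ofReal_le_ofReal hA0)))
    exact add_nonneg (mul_nonneg (by positivity) (sub_nonneg.2 hpow)) (by positivity)

/-- Stability of the localized minimum problem in the center and the
radius: for a dimensional constant `C'` (depending only on `d` and the growth constant
`C`), whenever `0 < ρ₁ < ρ₂ < dist(x₁,∂Ω)` and `|x₁-x₂| < min{ρ₁, ρ₂-ρ₁}`,
`m(x₂,ν,ρ₂) ≤ m(x₁,ν,ρ₁) + C' ρ₁^{d-2} |x₁-x₂| + C' (ρ₂^{d-1} - (√(ρ₁²-|x₁-x₂|²))^{d-1})`. -/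
theorem mloc_center_radius_stability (C : ℝ) (hC : 1 < C) :
    ∃ C' : ℝ, 0 < C' ∧
    ∀ (Ω : Set (EuclideanSpace ℝ (Fin d))), IsOpen Ω → Bornology.IsBounded Ω →
    ∀ g : EuclideanSpace ℝ (Fin d) → EuclideanSpace ℝ (Fin d) → ℝ,
      (∀ x ∈ Ω, ∀ ν, ‖ν‖ / C ≤ g x ν ∧ g x ν ≤ C * ‖ν‖) →
    ∀ x₁ x₂ : EuclideanSpace ℝ (Fin d), x₁ ∈ Ω → x₂ ∈ Ω →
    ∀ ν : EuclideanSpace ℝ (Fin d), ‖ν‖ = 1 →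
    ∀ ρ₁ ρ₂ : ℝ, 0 < ρ₁ → ρ₁ < ρ₂ → ρ₂ < infDist x₁ Ωᶜ →
      dist x₁ x₂ < min ρ₁ (ρ₂ - ρ₁) →
      mloc Ω g x₂ ν ρ₂ ≤ mloc Ω g x₁ ν ρ₁ +
        C' * ρ₁ ^ (d - 2) * dist x₁ x₂ +
        C' * (ρ₂ ^ (d - 1) -
          Real.sqrt (ρ₁ ^ 2 - dist x₁ x₂ ^ 2) ^ (d - 1)) := by
  rcases Nat.eq_zero_or_pos d with rfl | hd
  · refine ⟨1, one_pos, fun Ω _ _ g _ x₁ x₂ _ _ ν hν => ?_⟩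
    simp [Subsingleton.elim ν 0] at hν
  obtain ⟨K, hK, hcomp⟩ := exists_mloc_competitor_le hd
  have hC0 : 0 < C := by linarith
  refine ⟨C * K + 1, by positivity, ?_⟩
  intro Ω hΩ _ g hg x₁ x₂ _ _ ν hν ρ₁ ρ₂ hρ₁ _ hdist hmin
  have hs : dist x₁ x₂ + ρ₁ < ρ₂ := by linarith [hmin.trans_le (min_le_right _ _)]
  have hs0 : 0 ≤ dist x₁ x₂ := dist_nonneg
  have hball : closedBall x₁ ρ₂ ⊆ Ω := by
    intro y hy
    by_contra hyΩ
    have := infDist_le_dist_of_mem (x := x₁) (show y ∈ Ωᶜ from hyΩ)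
    rw [dist_comm] at this
    linarith [mem_closedBall.1 hy]
  have hsqrt : Real.sqrt (ρ₁ ^ 2 - dist x₁ x₂ ^ 2) ^ (d - 1) ≤ ρ₁ ^ (d - 1) := by
    gcongr
    exact Real.sqrt_le_iff.2 ⟨hρ₁.le, by nlinarith⟩
  have hpow : ρ₁ ^ (d - 1) ≤ ρ₂ ^ (d - 1) := pow_le_pow_left₀ hρ₁.le (by linarith) _
  rw [add_assoc, ← sub_le_iff_le_add]
  refine le_csInf ?_ ?_
  · obtain ⟨e, hmp, he, heν⟩ := exists_adapted_coordinates hd ν hν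
    have hrep := isSpinRep_graphSpin hmp he x₁ (h := 0) contDiff_const hΩ
    rw [← ujump_eq_graphSpin he heν] at hrep
    exact ⟨_, _, _, _, hrep, ⟨1, one_pos, ae_of_all _ fun _ _ _ => rfl⟩, rfl⟩
  · rintro _ ⟨v, σ, f, hrep, ⟨δ, hδ, hv⟩, rfl⟩
    obtain ⟨v', σ', f', hrep', hδ', hle⟩ := hcomp hC0 hΩ hg hν hρ₁ hs hball hδ hrep hv
    have hm : mloc Ω g x₂ ν ρ₂ ≤ surfE g σ' f' (ball x₂ ρ₂) := by
      refine csInf_le ⟨0, ?_⟩ ⟨v', σ', f', hrep', hδ', rfl⟩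
      rintro _ ⟨w, τ, n, hw, -, rfl⟩
      exact hw.surfE_nonneg hC0 hg _
    have h1 : C * K * (ρ₂ ^ (d - 1) - ρ₁ ^ (d - 1)) ≤ (C * K + 1) *
        (ρ₂ ^ (d - 1) - Real.sqrt (ρ₁ ^ 2 - dist x₁ x₂ ^ 2) ^ (d - 1)) := by
      gcongr
      linarith
    have h2 : 0 ≤ ρ₁ ^ (d - 2) * dist x₁ x₂ := by positivity
    linarith
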